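/- arXiv:2210.05887 — 3 statements merged into one kernel-verified Lean document; each statement's English description precedes it below -/
import Mathlib

section
/- Let X and Y be real Banach spaces and let H be a closed subspace of L(X*,Y) such that the rank-one operator x ⊗ y (given by x* ↦ x*(x)·y) belongs to H for every x ∈ X and y ∈ Y. If X* has the w*-Ball Small Combination of Slices Property and Y* has the w*-Ball Dentable Property, then H* has the w*-Ball Small Combination of Slices Property. -/
set_option synthInstance.maxHeartbeats 1000000
set_option maxHeartbeats 1000000
set_option maxSynthPendingDepth 3

open Metric Set Filter

noncomputable section

/-- A Banach space `Z` has the **Ball Dentable Property** (`BDP`) if its closed unit ball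
has slices of arbitrarily small diameter. -/
def BallDentableProperty (Z : Type*) [NormedAddCommGroup Z] [NormedSpace ℝ Z] : Prop :=
  ∀ ε : ℝ, 0 < ε → ∃ (f : StrongDual ℝ Z) (α : ℝ), ‖f‖ = 1 ∧ 0 < α ∧ α < 1 ∧
    Metric.diam {z : Z | ‖z‖ ≤ 1 ∧ 1 - α < f z} < ε

/-- The dual `Z*` of a Banach space `Z` has the **w*-Ball Dentable Property** (`w*-BDP`) if the
closed unit ball of `Z*` has weak-star slices (slices given by elements of the predual `Z`)
of arbitrarily small diameter. -/
def WStarBallDentableProperty (Z : Type*) [NormedAddCommGroup Z] [NormedSpace ℝ Z] : Prop :=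
  ∀ ε : ℝ, 0 < ε → ∃ (z : Z) (α : ℝ), ‖z‖ = 1 ∧ 0 < α ∧ α < 1 ∧
    Metric.diam {f : StrongDual ℝ Z | ‖f‖ ≤ 1 ∧ 1 - α < f z} < ε

/-- A Banach space `Z` has the **Ball Small Combination of Slices Property** (`BSCSP`) if its
closed unit ball has convex combinations of slices of arbitrarily small diameter. -/
def BallSCSProperty (Z : Type*) [NormedAddCommGroup Z] [NormedSpace ℝ Z] : Prop :=
  ∀ ε : ℝ, 0 < ε → ∃ (n : ℕ) (lam : Fin (n + 1) → ℝ) (f : Fin (n + 1) → StrongDual ℝ Z)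
    (α : Fin (n + 1) → ℝ),
    (∀ i, 0 < lam i) ∧ (∑ i, lam i = 1) ∧ (∀ i, ‖f i‖ = 1) ∧ (∀ i, 0 < α i ∧ α i < 1) ∧
    Metric.diam {z : Z | ∃ g : Fin (n + 1) → Z,
      (∀ i, ‖g i‖ ≤ 1 ∧ 1 - α i < f i (g i)) ∧ z = ∑ i, lam i • g i} < ε

/-- The dual `Z*` of a Banach space `Z` has the **w*-Ball Small Combination of Slices Property**
(`w*-BSCSP`) if the closed unit ball of `Z*` has convex combinations of weak-star slices
(slices given by elements of the predual `Z`) of arbitrarily small diameter. -/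
def WStarBallSCSProperty (Z : Type*) [NormedAddCommGroup Z] [NormedSpace ℝ Z] : Prop :=
  ∀ ε : ℝ, 0 < ε → ∃ (n : ℕ) (lam : Fin (n + 1) → ℝ) (z : Fin (n + 1) → Z)
    (α : Fin (n + 1) → ℝ),
    (∀ i, 0 < lam i) ∧ (∑ i, lam i = 1) ∧ (∀ i, ‖z i‖ = 1) ∧ (∀ i, 0 < α i ∧ α i < 1) ∧
    Metric.diam {φ : StrongDual ℝ Z | ∃ g : Fin (n + 1) → StrongDual ℝ Z,
      (∀ i, ‖g i‖ ≤ 1 ∧ 1 - α i < g i (z i)) ∧ φ = ∑ i, lam i • g i} < ε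

/-- The roughness `η(Z, u)` of the norm of `Z` at `u`:
`limsup_{‖h‖ → 0} (‖u + h‖ + ‖u - h‖ - 2) / ‖h‖`. -/
noncomputable def roughness (Z : Type*) [NormedAddCommGroup Z] (u : Z) : ℝ :=
  Filter.limsup (fun h : Z => (‖u + h‖ + ‖u - h‖ - 2) / ‖h‖) (nhdsWithin 0 {(0 : Z)}ᶜ)

/-- The norm of `Z` is **rough** if it is `ε`-rough for some `ε > 0`, i.e. there is `ε > 0`
with `η(Z, u) ≥ ε` for every `u` in the unit sphere of `Z`. -/
def RoughNorm (Z : Type*) [NormedAddCommGroup Z] : Prop :=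
  ∃ ε : ℝ, 0 < ε ∧ ∀ u : Z, ‖u‖ = 1 → ε ≤ roughness Z u

/-- The norm of `Z` is **non-rough** if it is not rough. -/
def NonRoughNorm (Z : Type*) [NormedAddCommGroup Z] : Prop := ¬ RoughNorm Z

/-- The rank-one operator `x* ⊗ y : E → F`, `x ↦ x*(x) • y`. -/
noncomputable def rankOneOp {E F : Type*} [NormedAddCommGroup E] [NormedSpace ℝ E]
    [NormedAddCommGroup F] [NormedSpace ℝ F] (f : StrongDual ℝ E) (y : F) : E →L[ℝ] F :=
  f.smulRight y

/-- For a subspace `H ⊆ L(E, F)`, a vector `x ∈ E` and a functional `g ∈ F*`, the functional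
`x ⊗ g ∈ H*` given by `T ↦ g (T x)`. -/
noncomputable def dualTensorFunctional {E F : Type*} [NormedAddCommGroup E] [NormedSpace ℝ E]
    [NormedAddCommGroup F] [NormedSpace ℝ F] (H : Submodule ℝ (E →L[ℝ] F)) (x : E)
    (g : StrongDual ℝ F) : StrongDual ℝ H :=
  g.comp ((ContinuousLinearMap.apply ℝ F x).comp H.subtypeL)

/-- The weak-star closed convex hull of a subset `S` of the dual `Z*`. -/
noncomputable def wStarClosedConvexHull (Z : Type*) [NormedAddCommGroup Z] [NormedSpace ℝ Z]
    (S : Set (StrongDual ℝ Z)) : Set (StrongDual ℝ Z) :=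
  StrongDual.toWeakDual ⁻¹'
    closure (convexHull ℝ (StrongDual.toWeakDual '' S))

/-- `D(Z, u)`: the set of norm-at-most-one functionals attaining the value `1` at `u`. -/
def dualFace (Z : Type*) [NormedAddCommGroup Z] [NormedSpace ℝ Z] (u : Z) :
    Set (StrongDual ℝ Z) := {h | ‖h‖ ≤ 1 ∧ h u = 1}

/-- `n(Z, u)`: the largest non-negative `k` such that
`k * ‖z‖ ≤ sup {|f z| : f ∈ D(Z, u)}` for every `z ∈ Z`. -/
noncomputable def nConstant (Z : Type*) [NormedAddCommGroup Z] [NormedSpace ℝ Z] (u : Z) : ℝ :=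
  sSup {k : ℝ | 0 ≤ k ∧ ∀ z : Z, k * ‖z‖ ≤ ⨆ f : dualFace Z u, |f.1 z|}

/-- The Banach space `B(X × Y)` of bounded bilinear forms on `X × Y`, realized as
`X →L[ℝ] Y →L[ℝ] ℝ`. -/
def BoundedBilinearForms (X Y : Type*) [NormedAddCommGroup X] [NormedSpace ℝ X]
    [NormedAddCommGroup Y] [NormedSpace ℝ Y] : Type _ :=
  X →L[ℝ] Y →L[ℝ] ℝ

noncomputable instance {X Y : Type*} [NormedAddCommGroup X] [NormedSpace ℝ X]
    [NormedAddCommGroup Y] [NormedSpace ℝ Y] : NormedAddCommGroup (BoundedBilinearForms X Y) :=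
  inferInstanceAs (NormedAddCommGroup (X →L[ℝ] Y →L[ℝ] ℝ))

noncomputable instance {X Y : Type*} [NormedAddCommGroup X] [NormedSpace ℝ X]
    [NormedAddCommGroup Y] [NormedSpace ℝ Y] : NormedSpace ℝ (BoundedBilinearForms X Y) :=
  inferInstanceAs (NormedSpace ℝ (X →L[ℝ] Y →L[ℝ] ℝ))

/-- The canonical image of the elementary tensor `x ⊗ y` in the dual of the space of bounded
bilinear forms on `X × Y`; it acts by `B ↦ B x y`. -/
noncomputable def projTensorElem {X Y : Type*} [NormedAddCommGroup X] [NormedSpace ℝ X]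
    [NormedAddCommGroup Y] [NormedSpace ℝ Y] (x : X) (y : Y) :
    StrongDual ℝ (BoundedBilinearForms X Y) :=
  (ContinuousLinearMap.apply ℝ ℝ y).comp (ContinuousLinearMap.apply ℝ (Y →L[ℝ] ℝ) x)

/-- The projective tensor product `X ⊗̂_π Y`, realized canonically (and isometrically) as the
closure of the span of the elementary tensors inside the dual of the Banach space of bounded
bilinear forms on `X × Y`.  (On elementary tensor combinations the dual norm coincides with the
projective norm, so this closed subspace is the canonical isometric copy of the completion
`X ⊗̂_π Y`.) -/
noncomputable def ProjectiveTensorProduct (X Y : Type*) [NormedAddCommGroup X] [NormedSpace ℝ X]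
    [NormedAddCommGroup Y] [NormedSpace ℝ Y] :
    Submodule ℝ (StrongDual ℝ (BoundedBilinearForms X Y)) :=
  (Submodule.span ℝ {φ | ∃ x y, φ = projTensorElem x y}).topologicalClosure

/-- The projective tensor product `X ⊗̂_π Y` as a Banach space. -/
def ProjectiveTensorSpace (X Y : Type*) [NormedAddCommGroup X] [NormedSpace ℝ X]
    [NormedAddCommGroup Y] [NormedSpace ℝ Y] : Type _ :=
  ↥(ProjectiveTensorProduct X Y)

noncomputable instance {X Y : Type*} [NormedAddCommGroup X] [NormedSpace ℝ X]
    [NormedAddCommGroup Y] [NormedSpace ℝ Y] : NormedAddCommGroup (ProjectiveTensorSpace X Y) :=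
  inferInstanceAs (NormedAddCommGroup ↥(ProjectiveTensorProduct X Y))

noncomputable instance {X Y : Type*} [NormedAddCommGroup X] [NormedSpace ℝ X]
    [NormedAddCommGroup Y] [NormedSpace ℝ Y] : NormedSpace ℝ (ProjectiveTensorSpace X Y) :=
  inferInstanceAs (NormedSpace ℝ ↥(ProjectiveTensorProduct X Y))

/-- The rank-one operator `x ⊗ y : X* → Y`, `x* ↦ x*(x) • y`. -/
noncomputable def injTensorElem {X Y : Type*} [NormedAddCommGroup X] [NormedSpace ℝ X]
    [NormedAddCommGroup Y] [NormedSpace ℝ Y] (x : X) (y : Y) :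
    StrongDual ℝ X →L[ℝ] Y :=
  (ContinuousLinearMap.apply ℝ ℝ x).smulRight y

/-- The injective tensor product `X ⊗̂_ε Y`, realized canonically (and isometrically) as the
closure of the span of the rank-one operators `x ⊗ y` inside the Banach space `L(X*, Y)`.
(On elementary tensor combinations the operator norm coincides with the injective norm, so this
closed subspace is the canonical isometric copy of the completion `X ⊗̂_ε Y`.) -/
noncomputable def InjectiveTensorProduct (X Y : Type*) [NormedAddCommGroup X] [NormedSpace ℝ X]
    [NormedAddCommGroup Y] [NormedSpace ℝ Y] :
    Submodule ℝ (StrongDual ℝ X →L[ℝ] Y) :=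
  (Submodule.span ℝ {T | ∃ x y, T = injTensorElem x y}).topologicalClosure

/-- The injective tensor product `X ⊗̂_ε Y` as a Banach space. -/
def InjectiveTensorSpace (X Y : Type*) [NormedAddCommGroup X] [NormedSpace ℝ X]
    [NormedAddCommGroup Y] [NormedSpace ℝ Y] : Type _ :=
  ↥(InjectiveTensorProduct X Y)

noncomputable instance {X Y : Type*} [NormedAddCommGroup X] [NormedSpace ℝ X]
    [NormedAddCommGroup Y] [NormedSpace ℝ Y] : NormedAddCommGroup (InjectiveTensorSpace X Y) :=
  inferInstanceAs (NormedAddCommGroup ↥(InjectiveTensorProduct X Y))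

noncomputable instance {X Y : Type*} [NormedAddCommGroup X] [NormedSpace ℝ X]
    [NormedAddCommGroup Y] [NormedSpace ℝ Y] : NormedSpace ℝ (InjectiveTensorSpace X Y) :=
  inferInstanceAs (NormedSpace ℝ ↥(InjectiveTensorProduct X Y))

end



lemma aux_norm_inj {X Y : Type*} [NormedAddCommGroup X] [NormedSpace ℝ X]
    [NormedAddCommGroup Y] [NormedSpace ℝ Y] (x : X) (y : Y) (hx : ‖x‖ = 1) (hy : ‖y‖ = 1) :
    ‖injTensorElem x y‖ = 1 := by
  apply le_antisymm
  · refine ContinuousLinearMap.opNorm_le_bound _ zero_le_one (fun f => ?_)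
    simp only [injTensorElem, ContinuousLinearMap.smulRight_apply, ContinuousLinearMap.apply_apply,
      norm_smul, hy]
    have := f.le_opNorm x
    rw [hx] at this
    linarith
  · obtain ⟨g, hg, hgx⟩ := exists_dual_vector'' ℝ x
    have h := (injTensorElem x y).le_opNorm g
    have hv : ‖injTensorElem x y g‖ = 1 := by
      simp [injTensorElem, norm_smul, hy, hgx, hx]
    rw [hv] at h
    have h2 := norm_nonneg (injTensorElem x y)
    nlinarith

lemma aux_approx {X Y : Type*} [NormedAddCommGroup X] [NormedSpace ℝ X]
    [NormedAddCommGroup Y] [NormedSpace ℝ Y] (x : X) (y : Y) (hx : ‖x‖ = 1) (hy : ‖y‖ = 1)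
    (T : StrongDual ℝ X →L[ℝ] Y) (hT : ‖T‖ ≤ 1) (t s : ℝ) (ht : 0 < t) (hs : 0 < s)
    (hts : 2 * t + s ≤ 1) :
    ∀ u : ℝ, (u = t ∨ u = -t) → ∃ (a : StrongDual ℝ X) (b : StrongDual ℝ Y),
      ‖a‖ ≤ 1 ∧ ‖b‖ ≤ 1 ∧ 1 - (2 * t + s) < a x ∧ 1 - (2 * t + s) < b y ∧
      ‖injTensorElem x y + u • T‖ - s < 1 + u * b (T a) := by
  intro u hu
  have hua : |u| = t := by
    rcases hu with rfl | rfl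
    · exact abs_of_pos ht
    · rw [abs_neg, abs_of_pos ht]
  obtain ⟨a, ha, haS⟩ := ContinuousLinearMap.exists_lt_apply_of_lt_opNorm
    (injTensorElem x y + u • T) (show ‖injTensorElem x y + u • T‖ - s < _ by linarith)
  obtain ⟨b, hb, hbS⟩ := exists_dual_vector'' ℝ ((injTensorElem x y + u • T) a)
  have hval : b ((injTensorElem x y + u • T) a) = a x * b y + u * b (T a) := by
    simp [injTensorElem]
  have hlow : 1 - t ≤ ‖injTensorElem x y + u • T‖ := by
    have h1 := norm_sub_le (injTensorElem x y + u • T) (u • T)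
    rw [add_sub_cancel_right, aux_norm_inj x y hx hy, norm_smul, Real.norm_eq_abs, hua] at h1
    nlinarith
  have hbS' : b ((injTensorElem x y + u • T) a) = ‖(injTensorElem x y + u • T) a‖ := by
    simpa using hbS
  have hbT : |b (T a)| ≤ 1 := by
    have h1 := b.le_opNorm (T a)
    have h2 := T.le_opNorm a
    have h3 : ‖T‖ * ‖a‖ ≤ 1 := mul_le_one₀ hT (norm_nonneg _) ha.le
    have h4 : ‖b‖ * ‖T a‖ ≤ 1 := mul_le_one₀ hb (norm_nonneg _) (h2.trans h3)
    rw [Real.norm_eq_abs] at h1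
    linarith
  have hubT : u * b (T a) ≤ t := by
    have := le_abs_self (u * b (T a))
    rw [abs_mul, hua] at this
    nlinarith
  have hax : |a x| ≤ 1 := by
    have h1 := a.le_opNorm x
    rw [Real.norm_eq_abs, hx] at h1
    linarith
  have hby : |b y| ≤ 1 := by
    have h1 := b.le_opNorm y
    rw [Real.norm_eq_abs, hy] at h1
    linarith
  rw [← hbS', hval] at haS
  have hp : 1 - (2 * t + s) < a x * b y := by linarith
  obtain ⟨hax1, hax2⟩ := abs_le.1 hax
  obtain ⟨hby1, hby2⟩ := abs_le.1 hby
  have hle : a x * b y ≤ 1 := by nlinarith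
  rcases le_or_gt 0 (a x) with h0 | h0
  · have hb0 : 0 ≤ b y := by
      by_contra hc
      push Not at hc
      nlinarith
    exact ⟨a, b, ha.le, hb, by nlinarith, by nlinarith, by linarith⟩
  · have hb0 : b y ≤ 0 := by
      by_contra hc
      push Not at hc
      nlinarith
    refine ⟨-a, -b, by rw [norm_neg]; exact ha.le, by rw [norm_neg]; exact hb, ?_, ?_, ?_⟩
    · simp only [ContinuousLinearMap.neg_apply]; nlinarith
    · simp only [ContinuousLinearMap.neg_apply]; nlinarith
    · simp only [ContinuousLinearMap.neg_apply, map_neg, neg_neg]; linarith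

lemma aux_dist_slice {Z : Type*} [NormedAddCommGroup Z] [NormedSpace ℝ Z]
    (S : Set (StrongDual ℝ Z)) (hS : ∀ f ∈ S, ‖f‖ ≤ 1) (ε : ℝ) (h : Metric.diam S < ε)
    (f g : StrongDual ℝ Z) (hf : f ∈ S) (hg : g ∈ S) : ‖f - g‖ ≤ ε := by
  have hb : Bornology.IsBounded S := by
    refine (Metric.isBounded_closedBall (x := (0 : StrongDual ℝ Z)) (r := 1)).subset ?_
    intro f hf
    simpa using hS f hf
  rw [← dist_eq_norm]
  exact (Metric.dist_le_diam_of_mem hb hf hg).trans h.le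

lemma aux_apply_le {Z W : Type*} [NormedAddCommGroup Z] [NormedSpace ℝ Z]
    [NormedAddCommGroup W] [NormedSpace ℝ W] (T : Z →L[ℝ] W) (hT : ‖T‖ ≤ 1)
    (a : Z) (b : StrongDual ℝ W) (c d : ℝ) (ha : ‖a‖ ≤ c) (hb : ‖b‖ ≤ d) :
    b (T a) ≤ d * c := by
  have h1 := b.le_opNorm (T a)
  have h2 := T.le_opNorm a
  have h3 : ‖T‖ * ‖a‖ ≤ c := by nlinarith [norm_nonneg a]
  have h4 : ‖b‖ * ‖T a‖ ≤ d * c :=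
    mul_le_mul hb (h2.trans h3) (norm_nonneg _) ((norm_nonneg _).trans hb)
  rw [Real.norm_eq_abs] at h1
  linarith [le_abs_self (b (T a))]

/-- Corollary 3.1: if `H` is a closed subspace of `L(X*, Y)` with `X ⊗ Y ⊆ H`,
`X*` has the `w*`-BSCSP and `Y*` has the `w*`-BDP, then `H*` has the `w*`-BSCSP. -/
theorem statement16 {X Y : Type*} [NormedAddCommGroup X] [NormedSpace ℝ X] [CompleteSpace X]
    [NormedAddCommGroup Y] [NormedSpace ℝ Y] [CompleteSpace Y]
    (H : Submodule ℝ (StrongDual ℝ X →L[ℝ] Y))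
    (hH : IsClosed (H : Set (StrongDual ℝ X →L[ℝ] Y)))
    (hmem : ∀ (x : X) (y : Y), injTensorElem x y ∈ H)
    (hX : WStarBallSCSProperty X) (hY : WStarBallDentableProperty Y) :
    WStarBallSCSProperty H := by
  intro ε hε
  obtain ⟨e, he⟩ : ∃ e, e = ε / 8 := ⟨_, rfl⟩
  have he0 : 0 < e := by rw [he]; linarith
  obtain ⟨n, lam, x, α, hlam, hsum, hx, hα, hdX⟩ := hX e he0
  obtain ⟨y, β, hy, hβ0, hβ1, hdY⟩ := hY e he0
  obtain ⟨i0, -, hi0⟩ := Finset.exists_min_image (Finset.univ : Finset (Fin (n + 1))) α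
    ⟨0, Finset.mem_univ _⟩
  obtain ⟨m, hm⟩ : ∃ m, m = min β (α i0) := ⟨_, rfl⟩
  have hm0 : 0 < m := by rw [hm]; exact lt_min hβ0 (hα i0).1
  have hmβ : m ≤ β := by rw [hm]; exact min_le_left _ _
  have hmα : ∀ i, m ≤ α i := fun i => by
    rw [hm]; exact (min_le_right _ _).trans (hi0 i (Finset.mem_univ _))
  obtain ⟨t, ht⟩ : ∃ t, t = m / (2 + e) := ⟨_, rfl⟩
  have ht0 : 0 < t := by rw [ht]; positivity
  have htm : 2 * t + e * t = m := by rw [ht]; field_simp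
  have hs0 : 0 < e * t := by positivity
  let z : Fin (n + 1) → H := fun i => ⟨injTensorElem (x i) y, hmem (x i) y⟩
  refine ⟨n, lam, z, fun _ => e * t, hlam, hsum, fun i => aux_norm_inj (x i) y (hx i) hy,
    fun _ => ⟨hs0, by linarith⟩, ?_⟩
  -- the one-sided estimate
  have key : ∀ (g g' : Fin (n + 1) → StrongDual ℝ H),
      (∀ i, ‖g i‖ ≤ 1 ∧ 1 - e * t < g i (z i)) → (∀ i, ‖g' i‖ ≤ 1 ∧ 1 - e * t < g' i (z i)) →
      ∀ T : H, ‖T‖ ≤ 1 → ∑ i, lam i * g i T - ∑ i, lam i * g' i T ≤ 7 * e := by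
    intro g g' hg hg' T hT
    have hT' : ‖(T : StrongDual ℝ X →L[ℝ] Y)‖ ≤ 1 := hT
    choose a b ha hb hax hby hab using fun i => aux_approx (x i) y (hx i) hy T.1 hT' t (e * t)
      ht0 hs0 (by linarith) t (Or.inl rfl)
    choose a' b' ha' hb' hax' hby' hab' using fun i => aux_approx (x i) y (hx i) hy T.1 hT' t
      (e * t) ht0 hs0 (by linarith) (-t) (Or.inr rfl)
    have hup : ∀ (f : StrongDual ℝ H) (i : Fin (n + 1)) (u : ℝ), ‖f‖ ≤ 1 →
        f (z i) + u * f T ≤ ‖injTensorElem (x i) y + u • T.1‖ := by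
      intro f i u hf
      have h1 := f.le_opNorm (z i + u • T)
      have h2 : ‖z i + u • T‖ = ‖injTensorElem (x i) y + u • T.1‖ := rfl
      rw [h2, Real.norm_eq_abs, map_add, map_smul, smul_eq_mul] at h1
      have h3 := le_abs_self (f (z i) + u * f T)
      nlinarith [norm_nonneg (injTensorElem (x i) y + u • T.1)]
    have hYd := fun f f' hf hf' => aux_dist_slice
      {f : StrongDual ℝ Y | ‖f‖ ≤ 1 ∧ 1 - β < f y} (fun f hf => hf.1) e hdY f f' hf hf'
    have hb0m : ‖b 0‖ ≤ 1 ∧ 1 - β < b 0 y := ⟨hb 0, by linarith [hby 0]⟩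
    have hstep : ∀ i, g i T - g' i T ≤ (b 0) (T.1 (a i)) - (b 0) (T.1 (a' i)) + 6 * e := by
      intro i
      have h1 := hup (g i) i t (hg i).1
      have h2 := hup (g' i) i (-t) (hg' i).1
      have h3 := aux_apply_le T.1 hT' (a i) (b i - b 0) 1 e (ha i)
        (hYd _ _ ⟨hb i, by linarith [hby i]⟩ hb0m)
      have h4 := aux_apply_le T.1 hT' (a' i) (b 0 - b' i) 1 e (ha' i)
        (hYd _ _ hb0m ⟨hb' i, by linarith [hby' i]⟩)
      simp only [ContinuousLinearMap.sub_apply] at h3 h4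
      have h5 := hab i
      have h6 := hab' i
      have h7 := (hg i).2
      have h8 := (hg' i).2
      have h9 : t * (g i T - g' i T) ≤ t * ((b i) (T.1 (a i)) - (b' i) (T.1 (a' i)) + 4 * e) := by
        linarith
      have h10 := le_of_mul_le_mul_left h9 ht0
      linarith
    have hfin : (b 0) (T.1 (∑ i, lam i • a i - ∑ i, lam i • a' i)) ≤ 1 * e := by
      refine aux_apply_le T.1 hT' _ (b 0) e 1 ?_ (hb 0)
      refine aux_dist_slice _ ?_ e hdX _ _ ⟨a, fun i => ⟨ha i, ?_⟩, rfl⟩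
        ⟨a', fun i => ⟨ha' i, ?_⟩, rfl⟩
      · rintro f ⟨c, hc, rfl⟩
        refine (norm_sum_le _ _).trans ?_
        rw [← hsum]
        refine Finset.sum_le_sum fun i _ => ?_
        rw [norm_smul, Real.norm_eq_abs, abs_of_pos (hlam i)]
        nlinarith [hlam i, (hc i).1]
      · linarith [hax i, hmα i]
      · linarith [hax' i, hmα i]
    simp only [map_sub, map_sum, map_smul, smul_eq_mul] at hfin
    have hle : ∑ i, lam i * (g i T - g' i T) ≤
        ∑ i, lam i * ((b 0) (T.1 (a i)) - (b 0) (T.1 (a' i)) + 6 * e) :=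
      Finset.sum_le_sum fun i _ => mul_le_mul_of_nonneg_left (hstep i) (hlam i).le
    simp only [mul_add, mul_sub, Finset.sum_add_distrib, Finset.sum_sub_distrib,
      ← Finset.sum_mul, hsum] at hle
    linarith
  refine lt_of_le_of_lt (Metric.diam_le_of_forall_dist_le (C := 7 * e) (by positivity) ?_)
    (by linarith)
  rintro _ ⟨g, hg, rfl⟩ _ ⟨g', hg', rfl⟩
  rw [dist_eq_norm]
  refine ContinuousLinearMap.opNorm_le_of_unit_norm (by positivity) ?_
  intro T hT
  have h1 := key g g' hg hg' T hT.le
  have h2 := key g' g hg' hg T hT.le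
  rw [Real.norm_eq_abs, abs_le]
  simp only [ContinuousLinearMap.sub_apply, ContinuousLinearMap.sum_apply,
    ContinuousLinearMap.smul_apply, smul_eq_mul]
  constructor <;> linarith
end

section
/- Let X and Y be real Banach spaces. If X* has the w*-Ball Dentable Property and Y* has the w*-Ball Small Combination of Slices Property, then the dual (X ⊗̂_ε Y)* of the injective tensor product has the w*-Ball Small Combination of Slices Property. -/
set_option synthInstance.maxHeartbeats 1000000
set_option maxHeartbeats 1000000
set_option maxSynthPendingDepth 3

open Metric Set Filter

/-- Elementary tensors are in the injective tensor product. -/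
theorem inj_mem {X Y : Type*} [NormedAddCommGroup X] [NormedSpace ℝ X]
    [NormedAddCommGroup Y] [NormedSpace ℝ Y] (x : X) (y : Y) :
    injTensorElem x y ∈ InjectiveTensorProduct X Y :=
  Submodule.le_topologicalClosure _ (Submodule.subset_span ⟨x, y, rfl⟩)

theorem inj_norm_le {X Y : Type*} [NormedAddCommGroup X] [NormedSpace ℝ X]
    [NormedAddCommGroup Y] [NormedSpace ℝ Y] (x : X) (y : Y) :
    ‖injTensorElem x y‖ ≤ ‖x‖ * ‖y‖ := by
  refine ContinuousLinearMap.opNorm_le_bound _ (by positivity) fun f => ?_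
  change ‖f x • y‖ ≤ _
  rw [norm_smul]
  have := f.le_opNorm x
  calc ‖f x‖ * ‖y‖ ≤ (‖f‖ * ‖x‖) * ‖y‖ := by gcongr
    _ = _ := by ring

/-- The map `y ↦ x ⊗ y`. -/
noncomputable def injJ {X : Type*} (Y : Type*) [NormedAddCommGroup X] [NormedSpace ℝ X]
    [NormedAddCommGroup Y] [NormedSpace ℝ Y] (x : X) :
    Y →L[ℝ] ↥(InjectiveTensorProduct X Y) :=
  LinearMap.mkContinuous
    { toFun := fun y => ⟨injTensorElem x y, inj_mem x y⟩
      map_add' := fun a b => by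
        ext f
        exact smul_add (f x) a b
      map_smul' := fun c a => by
        ext f
        exact smul_comm (f x) c a } ‖x‖ (fun y => inj_norm_le x y)

theorem injJ_apply {X Y : Type*} [NormedAddCommGroup X] [NormedSpace ℝ X]
    [NormedAddCommGroup Y] [NormedSpace ℝ Y] (x : X) (y : Y) (f : StrongDual ℝ X) :
    (injJ Y x y).1 f = f x • y := rfl

theorem injJ_norm_le {X Y : Type*} [NormedAddCommGroup X] [NormedSpace ℝ X]
    [NormedAddCommGroup Y] [NormedSpace ℝ Y] (x : X) : ‖injJ Y x‖ ≤ ‖x‖ :=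
  LinearMap.mkContinuous_norm_le _ (norm_nonneg _) _

theorem key_pos {X Y : Type*} [NormedAddCommGroup X] [NormedSpace ℝ X]
    [NormedAddCommGroup Y] [NormedSpace ℝ Y] (x : X) (hx : ‖x‖ = 1)
    (x0 : StrongDual ℝ X) (hx0 : ‖x0‖ ≤ 1) (hx0x : x0 x = 1) (α e δ : ℝ) (hα : 0 < α)
    (he : 0 < e) (hδ : δ ≤ α * e / 2)
    (hs : ∀ f : StrongDual ℝ X, ‖f‖ ≤ 1 → 1 - α < f x → ‖f - x0‖ ≤ e)
    (y : Y) (hy : ‖y‖ = 1) (φ : StrongDual ℝ ↥(InjectiveTensorProduct X Y)) (hφ : ‖φ‖ ≤ 1)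
    (hφy : 1 - δ < φ (injJ Y x y)) (T : ↥(InjectiveTensorProduct X Y)) (hT : ‖T‖ ≤ 1) :
    φ T - φ (injJ Y x (T.1 x0)) ≤ 3 * e := by
  have hTle : ∀ f : StrongDual ℝ X, ‖T.1 f‖ ≤ ‖f‖ := fun f => by
    have h1 := T.1.le_opNorm f
    have h2 : ‖T.1‖ ≤ 1 := hT
    nlinarith [norm_nonneg f]
  -- the case of a functional in the slice
  have hpos : ∀ f : StrongDual ℝ X, ‖f‖ ≤ 1 → 1 - α < f x →
      ‖f x • y + (α / 2) • (T.1 f - f x • T.1 x0)‖ ≤ 1 + 2 * e * (α / 2) := by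
    intro f hf hfx
    have h1 := hs f hf hfx
    have hfx1 : ‖f x‖ ≤ 1 := by
      have := f.le_opNorm x
      rw [hx] at this; linarith
    have h2 : ‖f x - 1‖ ≤ e := by
      have := (f - x0).le_opNorm x
      simp only [ContinuousLinearMap.sub_apply, hx0x, hx] at this
      linarith
    have h3 : T.1 f - f x • T.1 x0 = T.1 (f - x0) - (f x - 1) • T.1 x0 := by
      rw [map_sub, sub_smul, one_smul]; abel
    have h4 : ‖T.1 f - f x • T.1 x0‖ ≤ 2 * e := by
      rw [h3]
      refine (norm_sub_le _ _).trans ?_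
      rw [norm_smul]
      have a1 := hTle (f - x0)
      have a2 := hTle x0
      nlinarith [norm_nonneg (f x - 1), norm_nonneg (T.1 x0)]
    refine (norm_add_le _ _).trans ?_
    rw [norm_smul, norm_smul, hy, Real.norm_of_nonneg (by positivity : 0 ≤ α / 2)]
    nlinarith
  have hnorm : ‖injJ Y x y + (α / 2) • (T - injJ Y x (T.1 x0))‖ ≤ 1 + 2 * e * (α / 2) := by
    change ‖(injJ Y x y + (α / 2) • (T - injJ Y x (T.1 x0))).1‖ ≤ _
    refine ContinuousLinearMap.opNorm_le_of_unit_norm (by positivity) fun f hf => ?_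
    change ‖f x • y + (α / 2) • (T.1 f - f x • T.1 x0)‖ ≤ _
    by_cases c1 : 1 - α < f x
    · exact hpos f hf.le c1
    by_cases c2 : 1 - α < (-f) x
    · have := hpos (-f) (by rw [norm_neg]; exact hf.le) c2
      rw [← norm_neg]
      have h0 : -(f x • y + (α / 2) • (T.1 f - f x • T.1 x0)) =
          (-f) x • y + (α / 2) • (T.1 (-f) - (-f) x • T.1 x0) := by
        have h1 : (-f) x = -(f x) := rfl
        rw [h1, map_neg]
        module
      rw [h0]
      exact this
    · have h1 : ‖f x‖ ≤ 1 - α := by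
        rw [Real.norm_eq_abs, abs_le]
        simp only [ContinuousLinearMap.neg_apply] at c2
        constructor <;> linarith
      have h4 : ‖T.1 f - f x • T.1 x0‖ ≤ 2 := by
        refine (norm_sub_le _ _).trans ?_
        rw [norm_smul]
        have a1 := hTle f
        have a2 := hTle x0
        nlinarith [norm_nonneg (f x), norm_nonneg (T.1 x0)]
      refine (norm_add_le _ _).trans ?_
      rw [norm_smul, norm_smul, hy, Real.norm_of_nonneg (by positivity : 0 ≤ α / 2)]
      nlinarith
  have h5 : φ (injJ Y x y + (α / 2) • (T - injJ Y x (T.1 x0))) ≤ 1 + 2 * e * (α / 2) := by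
    refine (le_abs_self _).trans ((φ.le_opNorm _).trans ?_)
    nlinarith [norm_nonneg (injJ Y x y + (α / 2) • (T - injJ Y x (T.1 x0))), norm_nonneg φ]
  rw [map_add, map_smul, map_sub, smul_eq_mul] at h5
  by_contra hcon
  push Not at hcon
  nlinarith

theorem key_abs {X Y : Type*} [NormedAddCommGroup X] [NormedSpace ℝ X]
    [NormedAddCommGroup Y] [NormedSpace ℝ Y] (x : X) (hx : ‖x‖ = 1)
    (x0 : StrongDual ℝ X) (hx0 : ‖x0‖ ≤ 1) (hx0x : x0 x = 1) (α e δ : ℝ) (hα : 0 < α)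
    (he : 0 < e) (hδ : δ ≤ α * e / 2)
    (hs : ∀ f : StrongDual ℝ X, ‖f‖ ≤ 1 → 1 - α < f x → ‖f - x0‖ ≤ e)
    (y : Y) (hy : ‖y‖ = 1) (φ : StrongDual ℝ ↥(InjectiveTensorProduct X Y)) (hφ : ‖φ‖ ≤ 1)
    (hφy : 1 - δ < φ (injJ Y x y)) (T : ↥(InjectiveTensorProduct X Y)) (hT : ‖T‖ ≤ 1) :
    |φ T - φ (injJ Y x (T.1 x0))| ≤ 3 * e := by
  have h1 := key_pos x hx x0 hx0 hx0x α e δ hα he hδ hs y hy φ hφ hφy T hT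
  have h2 := key_pos x hx x0 hx0 hx0x α e δ hα he hδ hs y hy φ hφ hφy (-T)
    (by rw [norm_neg]; exact hT)
  have h3 : (-T).1 x0 = -(T.1 x0) := rfl
  rw [h3, map_neg, map_neg, map_neg] at h2
  rw [abs_le]
  constructor <;> linarith

theorem main_aux {X Y : Type*} [NormedAddCommGroup X] [NormedSpace ℝ X]
    [NormedAddCommGroup Y] [NormedSpace ℝ Y]
    (hX : WStarBallDentableProperty X) (hY : WStarBallSCSProperty Y) :
    WStarBallSCSProperty ↥(InjectiveTensorProduct X Y) := by
  intro ε hε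
  set e := ε / 10 with he_def
  have he : 0 < e := by positivity
  obtain ⟨x, α, hx, hα, hα1, hdX⟩ := hX e he
  obtain ⟨n, lam, y, β, hlam, hsum, hy, hβ, hdY⟩ := hY e he
  obtain ⟨x0, hx0, hx0x⟩ := exists_dual_vector ℝ x (by rw [← norm_ne_zero_iff, hx]; norm_num)
  have hx0x : x0 x = 1 := by rw [hx0x, hx]; norm_num
  have hs : ∀ f : StrongDual ℝ X, ‖f‖ ≤ 1 → 1 - α < f x → ‖f - x0‖ ≤ e := by
    intro f hf hfx
    rw [← dist_eq_norm]
    refine (Metric.dist_le_diam_of_mem ?_ ?_ ?_).trans hdX.le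
    · exact (Metric.isBounded_closedBall (x := (0 : StrongDual ℝ X)) (r := 1)).subset
        fun g hg => by simpa using hg.1
    · exact ⟨hf, hfx⟩
    · exact ⟨hx0.le, by rw [hx0x]; linarith⟩
  refine ⟨n, lam, fun i => injJ Y x (y i), fun i => min (β i) (α * e / 2), hlam, hsum, ?_, ?_, ?_⟩
  · intro i
    apply le_antisymm
    · have := (injJ Y x).le_opNorm (y i)
      have h2 := injJ_norm_le (Y := Y) x
      rw [hy i] at this
      linarith
    · have h1 := (injJ Y x (y i)).1.le_opNorm x0
      rw [injJ_apply, hx0x, one_smul, hy i, hx0, mul_one] at h1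
      exact h1
  · intro i
    exact ⟨lt_min (hβ i).1 (by positivity), (min_le_left _ _).trans_lt (hβ i).2⟩
  · refine lt_of_le_of_lt (Metric.diam_le_of_forall_dist_le (C := 7 * e) (by positivity) ?_)
      (by linarith)
    rintro _ ⟨g, hg, rfl⟩ _ ⟨g', hg', rfl⟩
    rw [dist_eq_norm]
    have hbdd : Bornology.IsBounded {φ : StrongDual ℝ Y | ∃ g : Fin (n + 1) → StrongDual ℝ Y,
        (∀ i, ‖g i‖ ≤ 1 ∧ 1 - β i < g i (y i)) ∧ φ = ∑ i, lam i • g i} := by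
      refine (Metric.isBounded_closedBall (x := (0 : StrongDual ℝ Y)) (r := 1)).subset ?_
      rintro _ ⟨k, hk, rfl⟩
      rw [mem_closedBall_zero_iff]
      refine (norm_sum_le _ _).trans ?_
      rw [← hsum]
      refine Finset.sum_le_sum fun i _ => ?_
      rw [norm_smul, Real.norm_of_nonneg (hlam i).le]
      nlinarith [hlam i, (hk i).1]
    have hmem : ∀ k : Fin (n + 1) → StrongDual ℝ ↥(InjectiveTensorProduct X Y),
        (∀ i, ‖k i‖ ≤ 1 ∧ 1 - min (β i) (α * e / 2) < k i (injJ Y x (y i))) →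
        ∀ i, ‖(k i).comp (injJ Y x)‖ ≤ 1 ∧ 1 - β i < ((k i).comp (injJ Y x)) (y i) := by
      intro k hk i
      constructor
      · refine (ContinuousLinearMap.opNorm_comp_le _ _).trans ?_
        have h2 := injJ_norm_le (Y := Y) x
        rw [hx] at h2
        nlinarith [(hk i).1, norm_nonneg (k i), norm_nonneg (injJ Y x)]
      · have := min_le_left (β i) (α * e / 2)
        have h2 := (hk i).2
        change _ < k i (injJ Y x (y i))
        linarith
    have hYd := (Metric.dist_le_diam_of_mem hbdd ⟨_, hmem g hg, rfl⟩ ⟨_, hmem g' hg', rfl⟩).trans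
      hdY.le
    rw [dist_eq_norm] at hYd
    have hclose : ∀ k : Fin (n + 1) → StrongDual ℝ ↥(InjectiveTensorProduct X Y),
        (∀ i, ‖k i‖ ≤ 1 ∧ 1 - min (β i) (α * e / 2) < k i (injJ Y x (y i))) →
        ∀ T : ↥(InjectiveTensorProduct X Y), ‖T‖ ≤ 1 →
        |(∑ i, lam i • k i) T - (∑ i, lam i • (k i).comp (injJ Y x)) (T.1 x0)| ≤ 3 * e := by
      intro k hk T hT
      have h0 : (∑ i, lam i • k i) T - (∑ i, lam i • (k i).comp (injJ Y x)) (T.1 x0)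
          = ∑ i, lam i * (k i T - k i (injJ Y x (T.1 x0))) := by
        simp only [ContinuousLinearMap.sum_apply, ContinuousLinearMap.smul_apply,
          ContinuousLinearMap.comp_apply, smul_eq_mul, mul_sub, Finset.sum_sub_distrib]
      rw [h0]
      refine (Finset.abs_sum_le_sum_abs _ _).trans ?_
      calc ∑ i, |lam i * (k i T - k i (injJ Y x (T.1 x0)))| ≤ ∑ i, lam i * (3 * e) := by
            refine Finset.sum_le_sum fun i _ => ?_
            rw [abs_mul, abs_of_pos (hlam i)]
            exact mul_le_mul_of_nonneg_left
              (key_abs x hx x0 hx0.le hx0x α e _ hα he (min_le_right _ _) hs (y i) (hy i) (k i)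
                (hk i).1 (hk i).2 T hT) (hlam i).le
        _ = 3 * e := by rw [← Finset.sum_mul, hsum, one_mul]
    refine ContinuousLinearMap.opNorm_le_of_unit_norm (by positivity) fun T hT => ?_
    have c1 := hclose g hg T hT.le
    have c2 := hclose g' hg' T hT.le
    have c3 := (ContinuousLinearMap.le_opNorm (∑ i, lam i • (g i).comp (injJ Y x) -
      ∑ i, lam i • (g' i).comp (injJ Y x)) (T.1 x0))
    have c4 : ‖T.1 x0‖ ≤ 1 := by
      have h1 := T.1.le_opNorm x0
      have h2 : ‖T.1‖ = 1 := hT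
      rw [h2, hx0] at h1
      linarith
    have c5 := c3.trans (mul_le_mul hYd c4 (norm_nonneg _) he.le)
    rw [ContinuousLinearMap.sub_apply, Real.norm_eq_abs] at c5
    rw [ContinuousLinearMap.sub_apply, Real.norm_eq_abs]
    rw [abs_le] at *
    constructor <;> linarith [c1.1, c1.2, c2.1, c2.2, c5.1, c5.2]

/-- Proposition 3.2: if `X*` has the `w*`-BDP and `Y*` has the `w*`-BSCSP, then
`(X ⊗̂_ε Y)*` has the `w*`-BSCSP. -/
theorem statement17 {X Y : Type*} [NormedAddCommGroup X] [NormedSpace ℝ X] [CompleteSpace X]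
    [NormedAddCommGroup Y] [NormedSpace ℝ Y] [CompleteSpace Y]
    (hX : WStarBallDentableProperty X) (hY : WStarBallSCSProperty Y) :
    WStarBallSCSProperty (InjectiveTensorSpace X Y) :=
  main_aux hX hY
end

section
/- Let X and Y be real Banach spaces and let H be a closed subspace of L(X*,Y) such that the rank-one operator x ⊗ y (given by x* ↦ x*(x)·y) belongs to H for every x ∈ X and y ∈ Y, and assume every T ∈ H is continuous from the weak-* topology of X* to the weak topology of Y. If H* has the w*-Ball Dentable Property, then both X* and Y* have the w*-Ball Dentable Property. -/
set_option synthInstance.maxHeartbeats 1000000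
set_option maxHeartbeats 1000000
set_option maxSynthPendingDepth 3

open Metric Set Filter

theorem dualTensorFunctional_norm_eq {X Y : Type*} [NormedAddCommGroup X] [NormedSpace ℝ X]
    [NormedAddCommGroup Y] [NormedSpace ℝ Y]
    (H : Submodule ℝ (StrongDual ℝ X →L[ℝ] Y))
    (hmem : ∀ (x : X) (y : Y), injTensorElem x y ∈ H)
    (f : StrongDual ℝ X) (g : StrongDual ℝ Y) :
    ‖dualTensorFunctional H f g‖ = ‖f‖ * ‖g‖ := by
  apply le_antisymm
  · refine ContinuousLinearMap.opNorm_le_bound _ (by positivity) fun T => ?_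
    have h1 : dualTensorFunctional H f g T = g ((T : StrongDual ℝ X →L[ℝ] Y) f) := rfl
    rw [h1]
    calc ‖g ((T : StrongDual ℝ X →L[ℝ] Y) f)‖
        ≤ ‖g‖ * ‖(T : StrongDual ℝ X →L[ℝ] Y) f‖ := g.le_opNorm _
      _ ≤ ‖g‖ * (‖(T : StrongDual ℝ X →L[ℝ] Y)‖ * ‖f‖) := by
          gcongr
          exact ContinuousLinearMap.le_opNorm _ _
      _ = ‖f‖ * ‖g‖ * ‖T‖ := by rw [Submodule.coe_norm]; ring
  · set C := ‖dualTensorFunctional H f g‖ with hC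
    have hC0 : 0 ≤ C := norm_nonneg _
    have key : ∀ (x : X) (y : Y), ‖f x‖ * ‖g y‖ ≤ C * ‖x‖ * ‖y‖ := by
      intro x y
      have h1 : dualTensorFunctional H f g ⟨injTensorElem x y, hmem x y⟩ = f x * g y := by
        change g (f x • y) = _
        simp
      have h2 := (dualTensorFunctional H f g).le_opNorm ⟨injTensorElem x y, hmem x y⟩
      rw [h1, norm_mul, ← hC] at h2
      have h3 : ‖(⟨injTensorElem x y, hmem x y⟩ : H)‖ ≤ ‖x‖ * ‖y‖ := by
        rw [Submodule.coe_norm]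
        refine ContinuousLinearMap.opNorm_le_bound _ (by positivity) fun φ => ?_
        change ‖φ x • y‖ ≤ _
        rw [norm_smul]
        have := φ.le_opNorm x
        calc ‖φ x‖ * ‖y‖ ≤ (‖φ‖ * ‖x‖) * ‖y‖ := by gcongr
          _ = ‖x‖ * ‖y‖ * ‖φ‖ := by ring
      calc _ ≤ C * _ := h2
        _ ≤ C * (‖x‖ * ‖y‖) := by gcongr
        _ = _ := by ring
    have key2 : ∀ x : X, ‖f x‖ * ‖g‖ ≤ C * ‖x‖ := by
      intro x
      have : ‖f x • g‖ ≤ C * ‖x‖ := by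
        refine ContinuousLinearMap.opNorm_le_bound _ (by positivity) fun y => ?_
        simpa using key x y
      simpa [norm_smul] using this
    have : ‖‖g‖ • f‖ ≤ C := by
      refine ContinuousLinearMap.opNorm_le_bound _ hC0 fun x => ?_
      simpa [mul_comm] using key2 x
    simpa [norm_smul, mul_comm] using this

theorem exists_slice_of_isometry {Z W : Type*} [NormedAddCommGroup Z] [NormedSpace ℝ Z]
    [NormedAddCommGroup W] [NormedSpace ℝ W] (J : StrongDual ℝ Z → StrongDual ℝ W)
    (hsub : ∀ f g, J (f - g) = J f - J g) (hnorm : ∀ f, ‖J f‖ = ‖f‖) (T : W) (z : Z)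
    (hJ : ∀ f, J f T = f z) (α ε : ℝ) (hα1 : α < 1) (hz : 1 - α < ‖z‖)
    (hd : Metric.diam {f : StrongDual ℝ W | ‖f‖ ≤ 1 ∧ 1 - α < f T} < ε) :
    ∃ (z : Z) (α : ℝ), ‖z‖ = 1 ∧ 0 < α ∧ α < 1 ∧
      Metric.diam {f : StrongDual ℝ Z | ‖f‖ ≤ 1 ∧ 1 - α < f z} < ε := by
  have hz0 : 0 < ‖z‖ := by linarith
  refine ⟨‖z‖⁻¹ • z, 1 - (1 - α) / ‖z‖, ?_, ?_, ?_, ?_⟩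
  · rw [norm_smul, norm_inv, norm_norm, inv_mul_cancel₀ hz0.ne']
  · have : (1 - α) / ‖z‖ < 1 := (div_lt_one hz0).2 hz
    linarith
  · have : 0 < (1 - α) / ‖z‖ := div_pos (by linarith) hz0
    linarith
  · refine lt_of_le_of_lt ?_ hd
    have hiso : Isometry J := Isometry.of_dist_eq fun f g => by
      rw [dist_eq_norm, dist_eq_norm, ← hsub, hnorm]
    rw [← hiso.diam_image]
    apply Metric.diam_mono
    · rintro _ ⟨f, ⟨hf, hf2⟩, rfl⟩
      refine ⟨(hnorm f).le.trans hf, ?_⟩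
      rw [hJ]
      have h3 : f (‖z‖⁻¹ • z) = f z / ‖z‖ := by
        rw [map_smul, smul_eq_mul, div_eq_inv_mul]
      rw [h3, sub_sub_cancel] at hf2
      exact (div_lt_div_iff_of_pos_right hz0).1 hf2
    · refine (Metric.isBounded_closedBall (x := (0 : StrongDual ℝ W)) (r := 1)).subset ?_
      rintro f ⟨hf, -⟩
      simpa using hf

theorem exists_eval_of_weakStar_continuous {X : Type*} [NormedAddCommGroup X] [NormedSpace ℝ X]
    (L : StrongDual ℝ X →L[ℝ] ℝ)
    (hL : Continuous fun φ : WeakDual ℝ X => L (WeakDual.toStrongDual φ)) :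
    ∃ z : X, ∀ f : StrongDual ℝ X, L f = f z := by
  let L' : StrongDual ℝ (WeakBilin (topDualPairing ℝ X)) :=
    ⟨L.toLinearMap, hL⟩
  obtain ⟨z, hz⟩ := LinearMap.dualEmbedding_surjective (topDualPairing ℝ X) L'
  refine ⟨z, fun f => ?_⟩
  have := DFunLike.congr_fun hz f
  exact this.symm

/-- Lemma 3.3: if `H` is a closed subspace of `L(X*, Y)` with `X ⊗ Y ⊆ H`, every
`T ∈ H` is `w*`-`w` continuous, and `H*` has the `w*`-BDP, then both `X*` and `Y*` have the
`w*`-BDP. -/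
theorem statement18 {X Y : Type*} [NormedAddCommGroup X] [NormedSpace ℝ X] [CompleteSpace X]
    [NormedAddCommGroup Y] [NormedSpace ℝ Y] [CompleteSpace Y]
    (H : Submodule ℝ (StrongDual ℝ X →L[ℝ] Y))
    (hH : IsClosed (H : Set (StrongDual ℝ X →L[ℝ] Y)))
    (hmem : ∀ (x : X) (y : Y), injTensorElem x y ∈ H)
    (hcont : ∀ T ∈ H, ∀ g : StrongDual ℝ Y,
      Continuous fun φ : WeakDual ℝ X => g (T (WeakDual.toStrongDual φ)))
    (hHs : WStarBallDentableProperty H) :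
    WStarBallDentableProperty X ∧ WStarBallDentableProperty Y := by
  have pick : ∀ ε : ℝ, 0 < ε → ∃ (T : H) (α : ℝ) (f : StrongDual ℝ X) (g : StrongDual ℝ Y),
      α < 1 ∧ ‖f‖ = 1 ∧ ‖g‖ = 1 ∧ 1 - α < g ((T : StrongDual ℝ X →L[ℝ] Y) f) ∧
      Metric.diam {F : StrongDual ℝ H | ‖F‖ ≤ 1 ∧ 1 - α < F T} < ε := by
    intro ε hε
    obtain ⟨T, α, hT, hα0, hα1, hd⟩ := hHs ε hε
    have hT' : 1 - α < ‖(T : StrongDual ℝ X →L[ℝ] Y)‖ := by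
      rw [← Submodule.coe_norm, hT]; linarith
    obtain ⟨f₀, hf₀, hTf⟩ := ContinuousLinearMap.exists_lt_apply_of_lt_opNorm _ hT'
    have hf₀0 : 0 < ‖f₀‖ := by
      rw [norm_pos_iff]
      rintro rfl
      simp at hTf
      linarith
    have hTf' : 1 - α < ‖(T : StrongDual ℝ X →L[ℝ] Y) (‖f₀‖⁻¹ • f₀)‖ := by
      rw [map_smul, norm_smul, norm_inv, norm_norm]
      have h1 : 1 ≤ ‖f₀‖⁻¹ := (one_le_inv₀ hf₀0).2 hf₀.le
      have h2 := le_mul_of_one_le_left (norm_nonneg ((T : StrongDual ℝ X →L[ℝ] Y) f₀)) h1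
      linarith
    obtain ⟨g, hg, hgT⟩ := exists_dual_vector ℝ
      ((T : StrongDual ℝ X →L[ℝ] Y) (‖f₀‖⁻¹ • f₀)) (lt_trans (by linarith) hTf').ne'
    refine ⟨T, α, ‖f₀‖⁻¹ • f₀, g, hα1, ?_, hg, ?_, hd⟩
    · rw [norm_smul, norm_inv, norm_norm, inv_mul_cancel₀ hf₀0.ne']
    · rw [hgT]; exact hTf'
  constructor
  · intro ε hε
    obtain ⟨T, α, f, g, hα1, hf, hg, hlt, hd⟩ := pick ε hε
    obtain ⟨z, hz⟩ := exists_eval_of_weakStar_continuous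
      (g.comp (T : StrongDual ℝ X →L[ℝ] Y)) (hcont T T.2 g)
    have hz' : ∀ φ : StrongDual ℝ X, g ((T : StrongDual ℝ X →L[ℝ] Y) φ) = φ z := hz
    refine exists_slice_of_isometry (fun φ => dualTensorFunctional H φ g) ?_ ?_ T z hz' α ε hα1
      ?_ hd
    · intro φ ψ
      ext S
      change g ((S : StrongDual ℝ X →L[ℝ] Y) (φ - ψ)) = g ((S : StrongDual ℝ X →L[ℝ] Y) φ)
        - g ((S : StrongDual ℝ X →L[ℝ] Y) ψ)
      rw [map_sub, map_sub]
    · intro φ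
      rw [dualTensorFunctional_norm_eq H hmem, hg, mul_one]
    · rw [hz'] at hlt
      have h1 := f.le_opNorm z
      rw [hf, one_mul] at h1
      exact hlt.trans_le ((le_abs_self _).trans h1)
  · intro ε hε
    obtain ⟨T, α, f, g, hα1, hf, hg, hlt, hd⟩ := pick ε hε
    refine exists_slice_of_isometry (fun ψ => dualTensorFunctional H f ψ) ?_ ?_ T
      ((T : StrongDual ℝ X →L[ℝ] Y) f) (fun _ => rfl) α ε hα1 ?_ hd
    · intro φ ψ
      ext S
      rfl
    · intro φ
      rw [dualTensorFunctional_norm_eq H hmem, hf, one_mul]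
    · have h1 := g.le_opNorm ((T : StrongDual ℝ X →L[ℝ] Y) f)
      rw [hg, one_mul] at h1
      exact hlt.trans_le ((le_abs_self _).trans h1)
end
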